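/- For all integers n, k ≥ 0: if n ≡ 2k+1 (mod 3), say n = 2k + 1 + 3m with m a nonnegative integer, then b(n,k) = binom(n+1, m) - 3·binom(n, m-1) (with the convention that binom(p, q) = 0 whenever q < 0); if n ≢ 2k+1 (mod 3) or n < 2k+1, then b(n,k) = 0. -/

import Mathlib

/- `a n k` and `b n k` satisfy `a n k = b (n-1) (k-1) + a (n-1) (k+1)` and
`b n k = a (n-1) k + b (n-1) (k+1)`, where a term with second index `-1` is
interpreted as `0`, with initial values `a 0 0 = 1`, `b 0 0 = 0` and
`a 0 k = b 0 k = 0` for `k ≥ 1`. -/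
mutual
  def a : ℕ → ℕ → ℕ
    | 0, 0 => 1
    | 0, _ + 1 => 0
    | n + 1, 0 => a n 1
    | n + 1, k + 1 => b n k + a n (k + 2)
  def b : ℕ → ℕ → ℕ
    | 0, _ => 0
    | n + 1, k => a n k + b n (k + 1)
end

/-- The binomial coefficient `binom p q` for natural `p` and integer `q`, with the
convention that it vanishes when `q < 0`. -/
def choInt (p : ℕ) (q : ℤ) : ℤ :=
  if q < 0 then 0 else Nat.choose p q.toNat

theorem choInt_of_neg (p : ℕ) {q : ℤ} (hq : q < 0) : choInt p q = 0 := if_pos hq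

theorem choInt_natCast (p q : ℕ) : choInt p q = p.choose q := by
  simp [choInt]

theorem choInt_succ (p : ℕ) (q : ℤ) :
    choInt (p + 1) q = choInt p q + choInt p (q - 1) := by
  rcases lt_or_ge q 0 with hq | hq
  · rw [choInt_of_neg _ hq, choInt_of_neg _ hq, choInt_of_neg _ (by omega), add_zero]
  · lift q to ℕ using hq
    cases q with
    | zero => simp [choInt]
    | succ q =>
      rw [show ((q + 1 : ℕ) : ℤ) - 1 = (q : ℤ) by push_cast; ring]
      simp only [choInt_natCast, Nat.choose_succ_succ, Nat.succ_eq_add_one]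
      push_cast
      ring

/-- The absorption identity `m * binom (n + 1) m = (n + 1) * binom n (m - 1)` at `n + 1 = 3 * m`. -/
theorem choInt_three_mul (n : ℕ) (m : ℤ) (h : (n : ℤ) + 1 = 3 * m) :
    choInt (n + 1) m = 3 * choInt n (m - 1) := by
  lift m to ℕ using by omega
  cases m with
  | zero => omega
  | succ m =>
    rw [show ((m + 1 : ℕ) : ℤ) - 1 = (m : ℤ) by push_cast; ring]
    simp only [choInt_natCast]
    have key : ((n : ℤ) + 1) * n.choose m = (n + 1).choose (m + 1) * ((m : ℤ) + 1) := by
      exact_mod_cast Nat.add_one_mul_choose_eq n m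
    push_cast at h
    have hm : (m : ℤ) + 1 ≠ 0 := by omega
    apply mul_right_cancel₀ hm
    rw [← key, h]
    ring

theorem a_eq_zero_and_b_eq_zero (n : ℕ) :
    (∀ k : ℕ, (∀ m : ℤ, (n : ℤ) ≠ 2 * k + 3 * m) → a n k = 0) ∧
    (∀ k : ℕ, (∀ m : ℤ, (n : ℤ) ≠ 2 * k + 1 + 3 * m) → b n k = 0) := by
  induction n with
  | zero =>
    refine ⟨fun k h => ?_, fun k _ => by rw [b]⟩
    cases k with
    | zero => exact absurd (by simp) (h 0)
    | succ k => rw [a]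
  | succ n ih =>
    obtain ⟨iha, ihb⟩ := ih
    refine ⟨fun k h => ?_, fun k h => ?_⟩
    · cases k with
      | zero =>
        rw [a]
        exact iha 1 fun m hm => h (m + 1) (by push_cast at *; omega)
      | succ k =>
        rw [a, ihb k fun m hm => h m (by push_cast at *; omega),
          iha (k + 2) fun m hm => h (m + 1) (by push_cast at *; omega)]
    · rw [b, iha k fun m hm => h m (by push_cast at *; omega),
        ihb (k + 1) fun m hm => h (m + 1) (by push_cast at *; omega)]

theorem a_and_b_closed_form (n : ℕ) :
    (∀ (k : ℕ) (m : ℤ), (n : ℤ) = 2 * k + 3 * m →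
      (a n k : ℤ) = choInt (n + 2) m - 4 * choInt (n + 1) (m - 1) + 3 * choInt n (m - 2)) ∧
    (∀ (k : ℕ) (m : ℤ), (n : ℤ) = 2 * k + 1 + 3 * m →
      (b n k : ℤ) = choInt (n + 1) m - 3 * choInt n (m - 1)) := by
  induction n with
  | zero =>
    refine ⟨fun k m h => ?_, fun k m h => ?_⟩
    · cases k with
      | zero =>
        obtain rfl : m = 0 := by push_cast at h; omega
        simp [a, choInt]
      | succ k =>
        push_cast at h
        rw [a, choInt_of_neg _ (by omega), choInt_of_neg _ (by omega), choInt_of_neg _ (by omega)]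
        simp
    · push_cast at h
      rw [b, choInt_of_neg _ (by omega), choInt_of_neg _ (by omega)]
      simp
  | succ n ih =>
    obtain ⟨iha, ihb⟩ := ih
    refine ⟨fun k m h => ?_, fun k m h => ?_⟩
    · have e₁ : m - 1 - 1 = m - 2 := by ring
      have e₂ : m - 2 - 1 = m - 3 := by ring
      have e₃ : m - 1 - 2 = m - 3 := by ring
      cases k with
      | zero =>
        have hc := choInt_three_mul n m (by push_cast at h; omega)
        rw [a, iha 1 (m - 1) (by push_cast at *; omega)]
        simp only [choInt_succ, e₁, e₂, e₃] at hc ⊢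
        linarith
      | succ k =>
        rw [a, Nat.cast_add, ihb k m (by push_cast at *; omega),
          iha (k + 2) (m - 1) (by push_cast at *; omega)]
        simp only [choInt_succ, e₁, e₂, e₃]
        ring
    · have e₁ : m - 1 - 1 = m - 2 := by ring
      rw [b, Nat.cast_add, iha k m (by push_cast at *; omega),
        ihb (k + 1) (m - 1) (by push_cast at *; omega)]
      simp only [e₁]
      ring

theorem b_closed_form (n k : ℕ) :
    (∀ m : ℕ, n = 2 * k + 1 + 3 * m →
      (b n k : ℤ) = choInt (n + 1) (m : ℤ) - 3 * choInt n ((m : ℤ) - 1)) ∧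
    ((¬ Int.ModEq 3 (n : ℤ) (2 * k + 1) ∨ n < 2 * k + 1) → b n k = 0) := by
  refine ⟨fun m h => (a_and_b_closed_form n).2 k m (by omega), fun h => ?_⟩
  by_cases hm : ∃ m : ℤ, (n : ℤ) = 2 * k + 1 + 3 * m
  · obtain ⟨m, hm⟩ := hm
    have hlt : n < 2 * k + 1 := h.resolve_left fun hn => hn (by unfold Int.ModEq; omega)
    have hb := (a_and_b_closed_form n).2 k m hm
    rw [choInt_of_neg _ (by omega), choInt_of_neg _ (by omega)] at hb
    simpa using hb
  · exact (a_eq_zero_and_b_eq_zero n).2 k fun m hn => hm ⟨m, hn⟩
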